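/- For every n ≥ 4, the path graph P_n on n vertices admits no topological integer additive set-graceful labeling with respect to any ground set X with |X| ≥ 2. -/

import Mathlib

open Finset Pointwise

/-- `f` is an integer additive set-graceful labeling (IASGL) of `G` with respect to the
ground set `X`: `f` is injective, assigns nonempty subsets of `X` to vertices, the induced
edge function `f⁺(uv) = f u + f v` (sumset) is injective on edges, and its image is exactly
the collection of subsets of `X` other than `∅` and `{0}`. -/
def IsIASGL {V : Type*} (G : SimpleGraph V) (X : Finset ℕ) (f : V → Finset ℕ) : Prop :=
  Function.Injective f ∧
  (∀ v, (f v).Nonempty ∧ f v ⊆ X) ∧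
  (∀ u v u' v', G.Adj u v → G.Adj u' v' → f u + f v = f u' + f v' → s(u, v) = s(u', v')) ∧
  (∀ A : Finset ℕ, (∃ u v, G.Adj u v ∧ f u + f v = A) ↔ A ⊆ X ∧ A.Nonempty ∧ A ≠ {0})

/-- `T` is a topology on the finite ground set `X`: a family of subsets of `X`
containing `∅` and `X` and closed under pairwise unions and intersections. -/
def IsTopologyFamily (X : Finset ℕ) (T : Set (Finset ℕ)) : Prop :=
  (∀ A ∈ T, A ⊆ X) ∧ (∅ : Finset ℕ) ∈ T ∧ X ∈ T ∧
  (∀ A ∈ T, ∀ B ∈ T, A ∪ B ∈ T) ∧ (∀ A ∈ T, ∀ B ∈ T, A ∩ B ∈ T)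

/-- `f` is a topological integer additive set-labeling (Top-IASL) of `G` w.r.t. `X`. -/
def IsTopIASL {V : Type*} (G : SimpleGraph V) (X : Finset ℕ) (f : V → Finset ℕ) : Prop :=
  Function.Injective f ∧
  (∀ v, (f v).Nonempty ∧ f v ⊆ X) ∧
  (∀ u v, G.Adj u v → f u + f v ⊆ X) ∧
  IsTopologyFamily X (insert ∅ (Set.range f))

/-- `f` is a topological integer additive set-graceful labeling (Top-IASGL) of `G`. -/
def IsTopIASGL {V : Type*} (G : SimpleGraph V) (X : Finset ℕ) (f : V → Finset ℕ) : Prop :=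
  IsIASGL G X f ∧ IsTopologyFamily X (insert ∅ (Set.range f))

/-- A sumset whose elements are at most `a` has a trivial summand, if `a` is positive and no
nonzero element of either summand is smaller than `a`. -/
theorem eq_zero_or_eq_zero_of_add_le {a : ℕ} (ha : 0 < a) {B C : Finset ℕ}
    (hB : B.Nonempty) (hC : C.Nonempty) (hBa : ∀ b ∈ B, b ≠ 0 → a ≤ b)
    (hCa : ∀ c ∈ C, c ≠ 0 → a ≤ c) (h : ∀ x ∈ B + C, x ≤ a) : B = {0} ∨ C = {0} := by
  by_contra! hne
  obtain ⟨b, hb, hb0⟩ : ∃ b ∈ B, b ≠ 0 := by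
    by_contra! hall
    exact hne.1 (eq_singleton_iff_nonempty_unique_mem.2 ⟨hB, hall⟩)
  obtain ⟨c, hc, hc0⟩ : ∃ c ∈ C, c ≠ 0 := by
    by_contra! hall
    exact hne.2 (eq_singleton_iff_nonempty_unique_mem.2 ⟨hC, hall⟩)
  have := h _ (add_mem_add hb hc)
  have := hBa b hb hb0
  have := hCa c hc hc0
  omega

/-- Only `{0}` can be added to a nonempty finite set without leaving it. -/
theorem eq_zero_of_add_subset_self {B X : Finset ℕ} (hB : B.Nonempty) (hX : X.Nonempty)
    (h : B + X ⊆ X) : B = {0} := by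
  refine eq_singleton_iff_nonempty_unique_mem.2 ⟨hB, fun b hb => ?_⟩
  have := X.le_max' _ (h (add_mem_add hb (X.max'_mem hX)))
  omega

theorem pathGraph_exists_adj {n : ℕ} (hn : 2 ≤ n) (w : Fin n) :
    ∃ u, (SimpleGraph.pathGraph n).Adj u w := by
  by_cases h : w.val = 0
  · exact ⟨⟨1, hn⟩, by rw [SimpleGraph.pathGraph_adj]; simp [h]⟩
  · refine ⟨⟨w.val - 1, by omega⟩, ?_⟩
    rw [SimpleGraph.pathGraph_adj]
    simp only
    omega

theorem pathGraph_neighbors_not_distinct {n : ℕ} {z p q r : Fin n}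
    (hp : (SimpleGraph.pathGraph n).Adj z p) (hq : (SimpleGraph.pathGraph n).Adj z q)
    (hr : (SimpleGraph.pathGraph n).Adj z r) : p = q ∨ p = r ∨ q = r := by
  simp only [SimpleGraph.pathGraph_adj] at hp hq hr
  simp only [Fin.ext_iff]
  omega

theorem IsIASGL.exists_adj_zero {V : Type*} {G : SimpleGraph V} {X : Finset ℕ}
    {f : V → Finset ℕ} (hf : IsIASGL G X f) {z : V} (hz : f z = {0}) {a : ℕ} (ha : 0 < a)
    (hmin : ∀ x ∈ X, x ≠ 0 → a ≤ x) {A : Finset ℕ} (hAX : A ⊆ X) (hA : A.Nonempty)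
    (hA0 : A ≠ {0}) (hle : ∀ x ∈ A, x ≤ a) : ∃ p, G.Adj z p ∧ f p = A := by
  obtain ⟨hinj, hsub, -, himg⟩ := hf
  obtain ⟨u, v, huv, rfl⟩ := (himg A).2 ⟨hAX, hA, hA0⟩
  rcases eq_zero_or_eq_zero_of_add_le ha (hsub u).1 (hsub v).1
    (fun b hb => hmin b ((hsub u).2 hb)) (fun c hc => hmin c ((hsub v).2 hc)) hle with h | h
  · obtain rfl := hinj (hz.trans h.symm)
    exact ⟨v, huv, by rw [hz, singleton_zero, zero_add]⟩
  · obtain rfl := hinj (hz.trans h.symm)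
    exact ⟨u, huv.symm, by rw [hz, singleton_zero, add_zero]⟩

theorem stmt_19 (n : ℕ) (hn : 4 ≤ n) (X : Finset ℕ) (hX : 2 ≤ X.card) :
    ¬ ∃ f : Fin n → Finset ℕ, IsTopIASGL (SimpleGraph.pathGraph n) X f := by
  rintro ⟨f, hf, -, -, hXT, -, -⟩
  have hXne : X.Nonempty := card_pos.1 (by omega)
  obtain ⟨w, hw⟩ : ∃ w, f w = X := hXT.resolve_left hXne.ne_empty
  obtain ⟨z, hzw⟩ := pathGraph_exists_adj (by omega) w
  have hsum : f z + f w ⊆ X := ((hf.2.2.2 _).1 ⟨z, w, hzw, rfl⟩).1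
  have hz : f z = {0} := eq_zero_of_add_subset_self (hf.2.1 z).1 hXne (hw ▸ hsum)
  have h0 : 0 ∈ X := (hf.2.1 z).2 (by simp [hz])
  have hne : (X.erase 0).Nonempty := card_pos.1 (by rw [card_erase_of_mem h0]; omega)
  obtain ⟨a, ha, hmin⟩ := (X.erase 0).exists_min_image id hne
  obtain ⟨ha0, haX⟩ := mem_erase.1 ha
  have hapos : 0 < a := Nat.pos_of_ne_zero ha0
  have hmin' : ∀ x ∈ X, x ≠ 0 → a ≤ x := fun x hx hx0 => hmin x (mem_erase.2 ⟨hx0, hx⟩)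
  obtain ⟨p, hzp, hp⟩ := hf.exists_adj_zero hz hapos hmin' (A := {a}) (by simpa using haX)
    (by simp) (by simpa using ha0) (by simp)
  obtain ⟨q, hzq, hq⟩ := hf.exists_adj_zero hz hapos hmin' (A := {0, a})
    (by simp [insert_subset_iff, h0, haX]) (by simp)
    (fun h => ha0 (mem_singleton.1 (h ▸ mem_insert_of_mem (mem_singleton_self a)))) (by simp)
  rcases pathGraph_neighbors_not_distinct hzp hzq hzw with rfl | rfl | rfl
  · have := congrArg card (hp.symm.trans hq)
    rw [card_singleton, card_pair ha0.symm] at this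
    omega
  · have := congrArg card (hp.symm.trans hw)
    rw [card_singleton] at this
    omega
  · have hX2 : X.card = 2 := by rw [← hw, hq, card_pair ha0.symm]
    have hcard := card_le_card_of_injOn (s := univ) (t := X.powerset.erase ∅) f
      (fun v _ => mem_coe.2 (mem_erase.2
        ⟨(hf.2.1 v).1.ne_empty, mem_powerset.2 (hf.2.1 v).2⟩)) hf.1.injOn
    rw [card_erase_of_mem (empty_mem_powerset X), card_powerset, hX2, card_univ,
      Fintype.card_fin] at hcard
    omega
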